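/- arXiv:1302.6431 — 3 statements merged into one kernel-verified Lean document; each statement's English description precedes it below -/
import Mathlib

section
/- (Theorem 3.1) Let N ≥ 1, let T_1, …, T_m ⊆ ℝ^N be closed sets and T = T_1 ∪ … ∪ T_m, and let H : ℝ^N × ℝ^N → ℝ be continuous. Suppose that for each i, u_i : ℝ^N → ℝ is locally Lipschitz continuous, nonnegative, vanishes on T_i, and is both a viscosity subsolution and a viscosity supersolution of u + H(x, Du) = 0 on ℝ^N ∖ T_i. Define ū(x) = min_{1≤i≤m} u_i(x) and, for each x, the active index set I(x) = {i : u_i(x) = ū(x)}. Assume condition (C): for every x ∈ ℝ^N ∖ T, every family of nonnegative weights (λ_i)_{i∈I(x)} with Σ_{i∈I(x)} λ_i = 1, and every choice of vectors ξ_i ∈ ∂^L u_i(x) for i ∈ I(x), one has H(x, Σ_{i∈I(x)} λ_i ξ_i) ≤ Σ_{i∈I(x)} λ_i H(x, ξ_i). Then ū vanishes on T and ū is both a viscosity subsolution and a viscosity supersolution of u + H(x, Du) = 0 on ℝ^N ∖ T. -/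
open Filter Topology RealInnerProductSpace

/-- The Fréchet subdifferential of `u : E → ℝ` at `x`. -/
def frechetSubdiff {E : Type*} [NormedAddCommGroup E] [InnerProductSpace ℝ E]
    (u : E → ℝ) (x : E) : Set E :=
  {p | ∀ ε > 0, ∀ᶠ y in 𝓝[≠] x, -ε ≤ (u y - u x - ⟪p, y - x⟫) / ‖y - x‖}

/-- The Fréchet superdifferential of `u : E → ℝ` at `x`. -/
def frechetSuperdiff {E : Type*} [NormedAddCommGroup E] [InnerProductSpace ℝ E]
    (u : E → ℝ) (x : E) : Set E :=
  {p | ∀ ε > 0, ∀ᶠ y in 𝓝[≠] x, (u y - u x - ⟪p, y - x⟫) / ‖y - x‖ ≤ ε}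

/-- The limiting superdifferential of `u` at `x`. -/
def limitingSuperdiff {E : Type*} [NormedAddCommGroup E] [InnerProductSpace ℝ E]
    (u : E → ℝ) (x : E) : Set E :=
  {p | ∃ xs : ℕ → E, ∃ ps : ℕ → E,
    Tendsto xs atTop (𝓝 x) ∧ Tendsto ps atTop (𝓝 p) ∧
    ∀ j, ps j ∈ frechetSuperdiff u (xs j)}

/-- `u` is a viscosity subsolution of `u + H(x, Du) = 0` on the open set `Ω`. -/
def IsSubsolution {E : Type*} [NormedAddCommGroup E] [InnerProductSpace ℝ E]
    (H : E → E → ℝ) (u : E → ℝ) (Ω : Set E) : Prop :=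
  ∀ x ∈ Ω, ∀ p ∈ frechetSuperdiff u x, u x + H x p ≤ 0

/-- `u` is a viscosity supersolution of `u + H(x, Du) = 0` on the open set `Ω`. -/
def IsSupersolution {E : Type*} [NormedAddCommGroup E] [InnerProductSpace ℝ E]
    (H : E → E → ℝ) (u : E → ℝ) (Ω : Set E) : Prop :=
  ∀ x ∈ Ω, ∀ p ∈ frechetSubdiff u x, 0 ≤ u x + H x p

section

variable {E : Type*} [NormedAddCommGroup E] [InnerProductSpace ℝ E]

/-- If `v - B ‖· - y‖²` has a local maximum at `z`, then `2 B (z - y)` is a Fréchet supergradient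
of `v` at `z`. -/
theorem mem_frechetSuperdiff_of_eventually_le {v : E → ℝ} {y z : E} {B : ℝ} (hB : 0 < B)
    (h : ∀ᶠ w in 𝓝 z, v w - B * ‖w - y‖ ^ 2 ≤ v z - B * ‖z - y‖ ^ 2) :
    (2 * B) • (z - y) ∈ frechetSuperdiff v z := by
  intro ε hε
  have hball : ∀ᶠ w in 𝓝 z, ‖w - z‖ < ε / B := by
    have := Metric.ball_mem_nhds z (div_pos hε hB)
    filter_upwards [this] with w hw
    simpa [dist_eq_norm] using hw
  filter_upwards [h.filter_mono nhdsWithin_le_nhds, hball.filter_mono nhdsWithin_le_nhds,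
    self_mem_nhdsWithin] with w hw hwz hne
  have hpos : 0 < ‖w - z‖ := norm_pos_iff.2 (sub_ne_zero.2 hne)
  rw [div_le_iff₀ hpos]
  have hexp : ‖w - y‖ ^ 2 = ‖w - z‖ ^ 2 + 2 * ⟪z - y, w - z⟫ + ‖z - y‖ ^ 2 := by
    have : w - y = (z - y) + (w - z) := by abel
    rw [this, norm_add_sq_real]; ring
  rw [hexp] at hw
  rw [real_inner_smul_left]
  rw [lt_div_iff₀ hB] at hwz
  nlinarith [mul_lt_mul_of_pos_right hwz hpos]

/-- A critical point of `y ↦ ∑ i, exp (K * (a i + ⟪p, y - x⟫ + A ‖y - x‖² + B ‖z i - y‖²))` writes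
`p + 2 A (y - x)` as a convex combination of the vectors `2 B (z i - y)`. -/
theorem exists_mem_stdSimplex_of_isLocalMin {ι : Type*} [Fintype ι] [Nonempty ι]
    {a : ι → ℝ} {z : ι → E} {x y p : E} {A B K : ℝ} (hK : 0 < K)
    (h : IsLocalMin (fun y => ∑ i, Real.exp
      (K * (a i + ⟪p, y - x⟫ + A * ‖y - x‖ ^ 2 + B * ‖z i - y‖ ^ 2))) y) :
    ∃ lam ∈ stdSimplex ℝ ι, p + (2 * A) • (y - x) = ∑ i, lam i • ((2 * B) • (z i - y)) := by
  set w : ι → ℝ := fun i => Real.exp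
      (K * (a i + ⟪p, y - x⟫ + A * ‖y - x‖ ^ 2 + B * ‖z i - y‖ ^ 2)) with hw
  have hwpos : ∀ i, 0 < w i := fun i => Real.exp_pos _
  have hS : 0 < ∑ i, w i := Finset.sum_pos (fun i _ => hwpos i) Finset.univ_nonempty
  have key : ∑ i, w i • (p + (2 * A) • (y - x) - (2 * B) • (z i - y)) = 0 := by
    have hx : HasFDerivAt (fun y : E => y - x) (ContinuousLinearMap.id ℝ E) y :=
      (hasFDerivAt_id y).sub_const x
    have hz : ∀ i, HasFDerivAt (fun y : E => z i - y) (-ContinuousLinearMap.id ℝ E) y :=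
      fun i => (hasFDerivAt_id y).const_sub (z i)
    have hp : HasFDerivAt (fun y : E => ⟪p, y - x⟫)
        ((innerSL ℝ p).comp (ContinuousLinearMap.id ℝ E)) y :=
      (innerSL ℝ p).hasFDerivAt.comp y hx
    have hd := HasFDerivAt.fun_sum (u := Finset.univ) (fun i (_ : i ∈ Finset.univ) =>
      ((((hp.const_add (a i)).add (hx.norm_sq.const_mul A)).add
        ((hz i).norm_sq.const_mul B)).const_mul K).exp)
    have h0 := h.hasFDerivAt_eq_zero hd
    set q := ∑ i, w i • (p + (2 * A) • (y - x) - (2 * B) • (z i - y)) with hq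
    have h1 := congrArg (fun f => f q) h0
    have h2 : K * ⟪q, q⟫ = 0 := by
      refine Eq.trans ?_ h1
      conv_lhs => rw [hq, sum_inner, Finset.mul_sum]
      simp only [sum_apply]
      refine Finset.sum_congr rfl fun i _ => ?_
      rw [← hq]
      simp only [hw, inner_add_left, inner_sub_left, real_inner_smul_left]
      simp
      ring
    have h3 : ⟪q, q⟫ = 0 := by
      rcases mul_eq_zero.1 h2 with h | h
      · exact absurd h hK.ne'
      · exact h
    exact inner_self_eq_zero.1 h3
  refine ⟨fun i => w i / ∑ j, w j, ⟨fun i => div_nonneg (hwpos i).le hS.le, ?_⟩, ?_⟩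
  · rw [← Finset.sum_div, div_self hS.ne']
  · simp only [smul_sub _ (p + (2 * A) • (y - x)), Finset.sum_sub_distrib, ← Finset.sum_smul] at key
    rw [sub_eq_zero] at key
    have : ∀ i, (w i / ∑ j, w j) • ((2 * B) • (z i - y))
        = (∑ j, w j)⁻¹ • (w i • ((2 * B) • (z i - y))) := by
      intro i
      rw [smul_smul (∑ j, w j)⁻¹, div_eq_inv_mul]
    simp only [this, ← Finset.smul_sum]
    rw [← key, inv_smul_smul₀ hS.ne']

/-- Approximate representation of a supergradient of a minimum of finitely many Lipschitz functions
as a convex combination of supergradients at nearby points. -/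
theorem exists_approx_convexCombination [FiniteDimensional ℝ E] {ι : Type*} [Fintype ι] [Nonempty ι]
    {u : ι → E → ℝ} {x p : E} {c L R : ℝ} (hL : 0 < L) (hR : 0 < R)
    (hLip : ∀ i, ∀ y ∈ Metric.closedBall x R, ∀ z ∈ Metric.closedBall x R,
      u i z - u i y ≤ L * ‖z - y‖)
    (hx : ∀ i, u i x = c)
    (hp : ∀ ε > 0, ∀ᶠ y in 𝓝 x, ∃ i, u i y ≤ c + ⟪p, y - x⟫ + ε * ‖y - x‖)
    {η : ℝ} (hη : 0 < η) :
    ∃ lam ∈ stdSimplex ℝ ι, ∃ z ξ : ι → E,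
      (∀ i, ‖z i - x‖ ≤ η ∧ ‖ξ i‖ ≤ 2 * L ∧ ξ i ∈ frechetSuperdiff (u i) (z i)) ∧
      ‖∑ i, lam i • ξ i - p‖ ≤ η := by
  classical
  obtain ⟨θ, hθ, hθη⟩ : ∃ θ : ℝ, 0 < θ ∧ 4 * θ = η := ⟨η / 4, by linarith, by ring⟩
  obtain ⟨s, hs, hsp⟩ := Metric.eventually_nhds_iff.1 (hp θ hθ)
  obtain ⟨r, hr, hrs, hrR, hrη⟩ : ∃ r : ℝ, 0 < r ∧ r < s ∧ 2 * r ≤ R ∧ 2 * r ≤ η := by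
    refine ⟨min (s / 2) (min (R / 2) (η / 2)), by positivity, ?_, ?_, ?_⟩
    · linarith [min_le_left (s / 2) (min (R / 2) (η / 2))]
    · linarith [min_le_right (s / 2) (min (R / 2) (η / 2)), min_le_left (R / 2) (η / 2)]
    · linarith [min_le_right (s / 2) (min (R / 2) (η / 2)), min_le_right (R / 2) (η / 2)]
  obtain ⟨A, hA, hAr⟩ : ∃ A : ℝ, 0 < A ∧ A * r = 2 * θ :=
    ⟨2 * θ / r, by positivity, by field_simp⟩
  obtain ⟨B, hB, hB1, hB2⟩ : ∃ B : ℝ, 0 < B ∧ 2 * L ≤ B * r ∧ L ^ 2 ≤ B * (θ * r) := by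
    refine ⟨2 * L / r + L ^ 2 / (θ * r), by positivity, ?_, ?_⟩
    · rw [add_mul, div_mul_cancel₀ _ hr.ne']
      have : 0 < L ^ 2 / (θ * r) * r := by positivity
      linarith
    · rw [add_mul, div_mul_cancel₀ _ (by positivity)]
      have : 0 < 2 * L / r * (θ * r) := by positivity
      linarith
  obtain ⟨K, hK, hKr⟩ : ∃ K : ℝ, 0 < K ∧ K * (θ * r / 2) = Fintype.card ι := by
    have : (0 : ℝ) < Fintype.card ι := by exact_mod_cast Fintype.card_pos
    exact ⟨Fintype.card ι / (θ * r / 2), by positivity, by field_simp⟩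
  have hsub : Metric.closedBall x (2 * r) ⊆ Metric.closedBall x R :=
    Metric.closedBall_subset_closedBall hrR
  have hrsub : Metric.closedBall x r ⊆ Metric.closedBall x (2 * r) :=
    Metric.closedBall_subset_closedBall (by linarith)
  have hcont : ∀ i, ContinuousOn (u i) (Metric.closedBall x (2 * r)) := by
    intro i
    refine (LipschitzOnWith.of_dist_le_mul (K := L.toNNReal) ?_).continuousOn
    intro a ha b hb
    rw [Real.coe_toNNReal _ hL.le, Real.dist_eq, abs_le, dist_eq_norm]
    have h1 := hLip i a (hsub ha) b (hsub hb)
    have h2 := hLip i b (hsub hb) a (hsub ha)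
    rw [norm_sub_rev b a] at h1
    exact ⟨by linarith, by linarith⟩
  set g : ι → E → E → ℝ := fun i y w =>
    K * ((c - u i w) + ⟪p, y - x⟫ + A * ‖y - x‖ ^ 2 + B * ‖w - y‖ ^ 2) with hg
  let S : Set (E × (ι → E)) :=
    Metric.closedBall x r ×ˢ Set.pi Set.univ fun _ => Metric.closedBall x (2 * r)
  have hScomp : IsCompact S :=
    (isCompact_closedBall x r).prod (isCompact_univ_pi fun _ => isCompact_closedBall x (2 * r))
  have hxS : ((x, fun _ => x) : E × (ι → E)) ∈ S := by
    refine ⟨Metric.mem_closedBall_self hr.le, fun _ _ => Metric.mem_closedBall_self (by linarith)⟩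
  have hFcont : ContinuousOn (fun q : E × (ι → E) => ∑ i, Real.exp (g i q.1 (q.2 i))) S := by
    refine continuousOn_finsetSum _ fun i _ => ?_
    have hu : ContinuousOn (fun q : E × (ι → E) => u i (q.2 i)) S :=
      (hcont i).comp (by fun_prop) fun q hq => hq.2 i (Set.mem_univ i)
    refine Real.continuous_exp.comp_continuousOn ?_
    have hrest : Continuous fun q : E × (ι → E) =>
        ⟪p, q.1 - x⟫ + A * ‖q.1 - x‖ ^ 2 + B * ‖q.2 i - q.1‖ ^ 2 := by fun_prop
    refine ((continuousOn_const (c := K)).mul (((continuousOn_const (c := c)).sub hu).add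
      hrest.continuousOn)).congr fun q _ => ?_
    simp only [hg, Pi.mul_apply, Pi.add_apply, Pi.sub_apply]
    ring
  obtain ⟨⟨y, z⟩, ⟨hy, hz⟩, hmin⟩ := hScomp.exists_isMinOn ⟨_, hxS⟩ hFcont
  have hz' : ∀ i, z i ∈ Metric.closedBall x (2 * r) := fun i => hz i (Set.mem_univ i)
  simp only at hy
  have hopt : ∀ i, ∀ w ∈ Metric.closedBall x (2 * r),
      u i w - B * ‖w - y‖ ^ 2 ≤ u i (z i) - B * ‖z i - y‖ ^ 2 := by
    intro i w hw
    by_contra! hlt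
    have hmem : ((y, Function.update z i w) : E × (ι → E)) ∈ S := by
      refine ⟨hy, fun j _ => ?_⟩
      by_cases hj : j = i
      · subst hj; simpa using hw
      · simpa [hj] using hz' j
    have hle := isMinOn_iff.1 hmin _ hmem
    refine absurd hle (not_le.2 (Finset.sum_lt_sum ?_ ⟨i, Finset.mem_univ i, ?_⟩))
    · intro j _
      by_cases hj : j = i
      · subst hj
        simp only [Function.update_self, Real.exp_le_exp, hg]
        exact mul_le_mul_of_nonneg_left (by linarith) hK.le
      · simp [hj]
    · simp only [Function.update_self, Real.exp_lt_exp, hg]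
      exact mul_lt_mul_of_pos_left (by linarith) hK
  have hBz : ∀ i, B * ‖z i - y‖ ≤ L := by
    intro i
    have h1 := hopt i y (hrsub hy)
    have h2 := hLip i y (hsub (hrsub hy)) (z i) (hsub (hz' i))
    rcases (norm_nonneg (z i - y)).eq_or_lt with h0 | h0
    · rw [← h0]; linarith
    · have h3 : ‖z i - y‖ * (B * ‖z i - y‖) ≤ ‖z i - y‖ * L := by
        simp only [sub_self, norm_zero] at h1
        nlinarith
      exact le_of_mul_le_mul_left h3 h0
  have hylt : ‖y - x‖ < r := by
    refine lt_of_le_of_ne (by simpa [dist_eq_norm] using hy) fun hyr => ?_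
    obtain ⟨i, hi⟩ := hsp (y := y) (by rw [dist_eq_norm, hyr]; exact hrs)
    have hle := isMinOn_iff.1 hmin _ hxS
    have hFx : ∑ j : ι, Real.exp (g j x x) = Fintype.card ι := by
      simp [hg, hx]
    have hgi : K * (θ * r / 2) ≤ g i y (z i) := by
      refine mul_le_mul_of_nonneg_left ?_ hK.le
      have h2 := hLip i y (hsub (hrsub hy)) (z i) (hsub (hz' i))
      rw [hyr] at hi ⊢
      have h3 : A * r ^ 2 = 2 * θ * r := by rw [pow_two, ← mul_assoc, hAr]
      have h4 : L * ‖z i - y‖ - B * ‖z i - y‖ ^ 2 ≤ θ * r / 2 := by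
        refine le_of_mul_le_mul_left (a := B) ?_ hB
        nlinarith [sq_nonneg (2 * B * ‖z i - y‖ - L), mul_pos hB (mul_pos hθ hr)]
      linarith
    have h5 : Real.exp (g i y (z i)) ≤ ∑ j, Real.exp (g j y (z j)) :=
      Finset.single_le_sum (f := fun j => Real.exp (g j y (z j)))
        (fun j _ => (Real.exp_pos _).le) (Finset.mem_univ i)
    have h6 := Real.add_one_le_exp (g i y (z i))
    simp only at hle
    linarith
  have hzlt : ∀ i, ‖z i - x‖ < 2 * r := by
    intro i
    have h1 : ‖z i - y‖ ≤ r := by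
      refine le_of_mul_le_mul_left (a := B) ?_ hB
      linarith [hBz i]
    calc ‖z i - x‖ = ‖(z i - y) + (y - x)‖ := by congr 1; abel
      _ ≤ ‖z i - y‖ + ‖y - x‖ := norm_add_le _ _
      _ < 2 * r := by linarith
  have hloc : IsLocalMin (fun y => ∑ i, Real.exp
      (K * ((c - u i (z i)) + ⟪p, y - x⟫ + A * ‖y - x‖ ^ 2 + B * ‖z i - y‖ ^ 2))) y := by
    have : Metric.closedBall x r ∈ 𝓝 y :=
      Metric.closedBall_mem_nhds_of_mem (by simpa [dist_eq_norm] using hylt)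
    filter_upwards [this] with y' hy'
    exact isMinOn_iff.1 hmin (y', z) ⟨hy', hz⟩
  obtain ⟨lam, hlam, heq⟩ := exists_mem_stdSimplex_of_isLocalMin hK hloc
  refine ⟨lam, hlam, z, fun i => (2 * B) • (z i - y), fun i => ⟨?_, ?_, ?_⟩, ?_⟩
  · linarith [hzlt i]
  · rw [norm_smul, Real.norm_of_nonneg (by positivity)]
    linarith [hBz i]
  · refine mem_frechetSuperdiff_of_eventually_le hB ?_
    have : Metric.closedBall x (2 * r) ∈ 𝓝 (z i) :=
      Metric.closedBall_mem_nhds_of_mem (by simpa [dist_eq_norm] using hzlt i)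
    filter_upwards [this] with w hw using hopt i w hw
  · rw [← heq, add_sub_cancel_left, norm_smul, Real.norm_of_nonneg (by positivity)]
    nlinarith

/-- A supergradient of a minimum of finitely many locally Lipschitz functions, all active at `x`,
is a convex combination of limiting supergradients. -/
theorem exists_convexCombination_limitingSuperdiff [FiniteDimensional ℝ E]
    {ι : Type*} [Fintype ι] [Nonempty ι] {u : ι → E → ℝ} {x p : E} {c : ℝ}
    (hLip : ∀ i, LocallyLipschitz (u i)) (hx : ∀ i, u i x = c)
    (hp : ∀ ε > 0, ∀ᶠ y in 𝓝 x, ∃ i, u i y ≤ c + ⟪p, y - x⟫ + ε * ‖y - x‖) :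
    ∃ lam ∈ stdSimplex ℝ ι, ∃ ξ : ι → E,
      (∀ i, ξ i ∈ limitingSuperdiff (u i) x) ∧ p = ∑ i, lam i • ξ i := by
  choose C t ht hCt using fun i => hLip i x
  have hev : ∀ᶠ R in 𝓝[>] (0 : ℝ), ∀ i, Metric.closedBall x R ⊆ t i := by
    rw [eventually_all]
    intro i
    obtain ⟨ε, hε, hsub⟩ := Metric.nhds_basis_closedBall.mem_iff.1 (ht i)
    filter_upwards [Ioc_mem_nhdsGT hε] with R hR
    exact (Metric.closedBall_subset_closedBall hR.2).trans hsub
  obtain ⟨R, hRt, hR⟩ := (hev.and self_mem_nhdsWithin).exists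
  set L : ℝ := 1 + ∑ i, (C i : ℝ)
  have hL : 0 < L := by positivity
  have hCL : ∀ i, (C i : ℝ) ≤ L := by
    intro i
    have := Finset.single_le_sum (f := fun j => (C j : ℝ)) (fun j _ => (C j).2) (Finset.mem_univ i)
    linarith
  have hLip' : ∀ i, ∀ y ∈ Metric.closedBall x R, ∀ z ∈ Metric.closedBall x R,
      u i z - u i y ≤ L * ‖z - y‖ := by
    intro i y hy z hz
    have h1 := (hCt i).dist_le_mul z (hRt i hz) y (hRt i hy)
    rw [Real.dist_eq, dist_eq_norm] at h1
    exact (le_abs_self _).trans (h1.trans (mul_le_mul_of_nonneg_right (hCL i) (norm_nonneg _)))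
  choose lam hlam z ξ hzξ hsum using fun n : ℕ =>
    exists_approx_convexCombination hL hR hLip' hx hp (Nat.one_div_pos_of_nat (n := n) (α := ℝ))
  have hcomp : IsCompact ((stdSimplex ℝ ι) ×ˢ
      Set.pi Set.univ fun _ : ι => Metric.closedBall (0 : E) (2 * L)) :=
    (isCompact_stdSimplex ℝ ι).prod (isCompact_univ_pi fun _ => isCompact_closedBall _ _)
  obtain ⟨⟨lam₀, ξ₀⟩, ⟨hlam₀, -⟩, φ, hφ, hlim⟩ := hcomp.tendsto_subseq
    (x := fun n => (lam n, ξ n))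
    (fun n => ⟨hlam n, fun i _ => by simpa using (hzξ n i).2.1⟩)
  have hlim1 : Tendsto (fun n => lam (φ n)) atTop (𝓝 lam₀) :=
    (continuous_fst.tendsto _).comp hlim
  have hlim2 : Tendsto (fun n => ξ (φ n)) atTop (𝓝 ξ₀) :=
    (continuous_snd.tendsto _).comp hlim
  have h0 : Tendsto (fun n => 1 / ((φ n : ℝ) + 1)) atTop (𝓝 0) :=
    tendsto_one_div_add_atTop_nhds_zero_nat.comp hφ.tendsto_atTop
  refine ⟨lam₀, hlam₀, ξ₀, fun i => ⟨fun n => z (φ n) i, fun n => ξ (φ n) i, ?_,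
    tendsto_pi_nhds.1 hlim2 i, fun n => (hzξ (φ n) i).2.2⟩, ?_⟩
  · rw [tendsto_iff_norm_sub_tendsto_zero]
    exact squeeze_zero (fun _ => norm_nonneg _) (fun n => (hzξ (φ n) i).1) h0
  · have hl1 : Tendsto (fun n => ∑ i, lam (φ n) i • ξ (φ n) i) atTop (𝓝 p) := by
      rw [tendsto_iff_norm_sub_tendsto_zero]
      exact squeeze_zero (fun _ => norm_nonneg _) (fun n => hsum (φ n)) h0
    have hl2 : Tendsto (fun n => ∑ i, lam (φ n) i • ξ (φ n) i) atTop
        (𝓝 (∑ i, lam₀ i • ξ₀ i)) :=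
      tendsto_finsetSum _ fun i _ =>
        (tendsto_pi_nhds.1 hlim1 i).smul (tendsto_pi_nhds.1 hlim2 i)
    exact tendsto_nhds_unique hl1 hl2

/-- The subsolution inequality passes to limiting supergradients. -/
theorem IsSubsolution.le_of_mem_limitingSuperdiff {H : E → E → ℝ}
    (hH : Continuous (Function.uncurry H)) {v : E → ℝ} (hv : Continuous v) {Ω : Set E}
    (hΩ : IsOpen Ω) (h : IsSubsolution H v Ω) {x ξ : E} (hx : x ∈ Ω)
    (hξ : ξ ∈ limitingSuperdiff v x) : v x + H x ξ ≤ 0 := by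
  obtain ⟨xs, ps, hxs, hps, hmem⟩ := hξ
  have hlim : Tendsto (fun n => v (xs n) + H (xs n) (ps n)) atTop (𝓝 (v x + H x ξ)) :=
    ((hv.tendsto x).comp hxs).add ((hH.tendsto (x, ξ)).comp (hxs.prodMk_nhds hps))
  refine le_of_tendsto hlim ?_
  filter_upwards [hxs.eventually (hΩ.mem_nhds hx)] with n hn using h _ hn _ (hmem n)

/-- If `v ≤ w` with equality at `x`, then subgradients of `v` at `x` are subgradients of `w`. -/
theorem frechetSubdiff_subset_of_le {v w : E → ℝ} {x : E} (hle : ∀ y, v y ≤ w y)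
    (hx : v x = w x) : frechetSubdiff v x ⊆ frechetSubdiff w x := by
  intro p hp ε hε
  filter_upwards [hp ε hε] with y hy
  refine hy.trans (div_le_div_of_nonneg_right ?_ (norm_nonneg _))
  linarith [hle y]

end

/-- Theorem 3.1 of the paper. -/
theorem stmt4 (N m : ℕ) (hN : 1 ≤ N) (hm : 1 ≤ m)
    (T : Fin m → Set (EuclideanSpace ℝ (Fin N))) (hT : ∀ i, IsClosed (T i))
    (H : EuclideanSpace ℝ (Fin N) → EuclideanSpace ℝ (Fin N) → ℝ)
    (hH : Continuous (Function.uncurry H))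
    (u : Fin m → EuclideanSpace ℝ (Fin N) → ℝ)
    (hLip : ∀ i, LocallyLipschitz (u i))
    (hnonneg : ∀ i x, 0 ≤ u i x)
    (hvanish : ∀ i, ∀ x ∈ T i, u i x = 0)
    (hsub : ∀ i, IsSubsolution H (u i) (T i)ᶜ)
    (hsup : ∀ i, IsSupersolution H (u i) (T i)ᶜ)
    -- Condition (C): weights are supported on the active index set
    -- `I(x) = {i : u i x = ⨅ k, u k x}`.
    (hC : ∀ x ∉ ⋃ i, T i, ∀ lam : Fin m → ℝ, ∀ ξ : Fin m → EuclideanSpace ℝ (Fin N),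
      (∀ i, 0 ≤ lam i) →
      (∀ i, u i x ≠ (⨅ k, u k x) → lam i = 0) →
      (∑ i, lam i) = 1 →
      (∀ i, u i x = (⨅ k, u k x) → ξ i ∈ limitingSuperdiff (u i) x) →
      H x (∑ i, lam i • ξ i) ≤ ∑ i, lam i * H x (ξ i)) :
    (∀ x ∈ ⋃ i, T i, (⨅ i, u i x) = 0) ∧
    IsSubsolution H (fun y => ⨅ i, u i y) (⋃ i, T i)ᶜ ∧
    IsSupersolution H (fun y => ⨅ i, u i y) (⋃ i, T i)ᶜ := by
  classical
  have : Nonempty (Fin m) := ⟨⟨0, hm⟩⟩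
  have hle : ∀ y i, (⨅ k, u k y) ≤ u i y := fun y i => ciInf_le (Set.finite_range _).bddBelow i
  have hatt : ∀ y, ∃ i, u i y = ⨅ k, u k y := fun y => exists_eq_ciInf_of_finite
  refine ⟨?_, ?_, ?_⟩
  · intro x hx
    obtain ⟨i, hi⟩ := Set.mem_iUnion.1 hx
    exact le_antisymm ((hle x i).trans_eq (hvanish i x hi)) (le_ciInf fun k => hnonneg k x)
  · intro x hx p hp
    have hxT : ∀ i, x ∈ (T i)ᶜ := fun i hi => hx (Set.mem_iUnion.2 ⟨i, hi⟩)
    set c := ⨅ k, u k x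
    let ι := {i : Fin m // u i x = c}
    have : Nonempty ι := let ⟨i, hi⟩ := hatt x; ⟨⟨i, hi⟩⟩
    have hact : ∀ᶠ y in 𝓝 x, ∀ i, u i y = (⨅ k, u k y) → u i x = c := by
      rw [eventually_all]
      intro i
      by_cases hi : u i x = c
      · exact Eventually.of_forall fun _ _ => hi
      · obtain ⟨j, hj⟩ := hatt x
        have hlt : u j x < u i x := by
          rw [hj]; exact lt_of_le_of_ne (hle x i) (Ne.symm hi)
        filter_upwards [(hLip j).continuous.continuousAt.eventually_lt
          (hLip i).continuous.continuousAt hlt] with y hy hiy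
        exact absurd (hle y j) (by rw [← hiy]; exact not_le.2 hy)
    have hp' : ∀ ε > 0, ∀ᶠ y in 𝓝 x, ∃ i : ι, u i y ≤ c + ⟪p, y - x⟫ + ε * ‖y - x‖ := by
      intro ε hε
      filter_upwards [hact, eventually_nhdsWithin_iff.1 (hp ε hε)] with y hy hpy
      obtain ⟨i, hi⟩ := hatt y
      refine ⟨⟨i, hy i hi⟩, ?_⟩
      by_cases hyx : y = x
      · subst hyx
        simp [hy i hi]
      · have h1 := hpy hyx
        rw [div_le_iff₀ (norm_pos_iff.2 (sub_ne_zero.2 hyx))] at h1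
        simp only [hi]
        linarith
    obtain ⟨lam, hlam, ξ, hξ, hpe⟩ := exists_convexCombination_limitingSuperdiff
      (u := fun i : ι => u i) (fun i => hLip i) (fun i => i.2) hp'
    let lam' : Fin m → ℝ := fun i => if h : u i x = c then lam ⟨i, h⟩ else 0
    let ξ' : Fin m → EuclideanSpace ℝ (Fin N) := fun i => if h : u i x = c then ξ ⟨i, h⟩ else 0
    have hlam' : ∀ i : ι, lam' i = lam i := fun i => dif_pos i.2
    have hξ' : ∀ i : ι, ξ' i = ξ i := fun i => dif_pos i.2
    have hlam0 : ∀ i, u i x ≠ c → lam' i = 0 := fun i hi => dif_neg hi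
    have hsumext : ∀ {M : Type} [AddCommMonoid M] (f : Fin m → M), (∀ i, u i x ≠ c → f i = 0) →
        ∑ i, f i = ∑ i : ι, f i := by
      intro M _ f hf
      rw [← Finset.sum_subtype (Finset.univ.filter fun i => u i x = c) (by simp) f]
      refine (Finset.sum_subset (Finset.filter_subset _ _) fun i _ hi => hf i ?_).symm
      simpa using hi
    have hsum1 : ∑ i, lam' i = 1 := by
      rw [← hlam.2, hsumext lam' hlam0]
      exact Finset.sum_congr rfl fun i _ => hlam' i
    have hsum2 : ∑ i, lam' i • ξ' i = p := by
      rw [hpe, hsumext _ fun i hi => by rw [hlam0 i hi, zero_smul]]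
      exact Finset.sum_congr rfl fun i _ => by rw [hlam' i, hξ' i]
    have hlim : ∀ i, u i x = c → ξ' i ∈ limitingSuperdiff (u i) x := by
      intro i hi
      rw [hξ' ⟨i, hi⟩]
      exact hξ ⟨i, hi⟩
    have hnn : ∀ i, 0 ≤ lam' i := by
      intro i
      by_cases hi : u i x = c
      · rw [hlam' ⟨i, hi⟩]; exact hlam.1 _
      · rw [hlam0 i hi]
    have hmain := hC x hx lam' ξ' hnn hlam0 hsum1 hlim
    rw [hsum2] at hmain
    have hbound : ∑ i, lam' i * H x (ξ' i) ≤ ∑ i, lam' i * (-c) := by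
      refine Finset.sum_le_sum fun i _ => ?_
      by_cases hi : u i x = c
      · refine mul_le_mul_of_nonneg_left ?_ (hnn i)
        have := (hsub i).le_of_mem_limitingSuperdiff hH (hLip i).continuous (hT i).isOpen_compl
          (hxT i) (hlim i hi)
        linarith
      · simp [hlam0 i hi]
    rw [← Finset.sum_mul, hsum1] at hbound
    show c + H x p ≤ 0
    linarith
  · intro x hx p hp
    obtain ⟨i, hi⟩ := hatt x
    have h := hsup i x (fun h => hx (Set.mem_iUnion.2 ⟨i, h⟩)) p
      (frechetSubdiff_subset_of_le (fun y => hle y i) hi.symm hp)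
    show 0 ≤ (⨅ k, u k x) + H x p
    rwa [← hi]
end

section
/- (Max rule for lower envelopes) Let N ≥ 1 and let f_1, …, f_m : ℝ^N → ℝ be locally Lipschitz continuous functions, and set ū(x) = min_{1≤i≤m} f_i(x) with active index set I(x) = {i : f_i(x) = ū(x)}. Then for every x ∈ ℝ^N and every p ∈ ∂⁺ū(x), there exist nonnegative weights (λ_i)_{i∈I(x)} with Σ_{i∈I(x)} λ_i = 1 and vectors ξ_i ∈ ∂^L f_i(x) for i ∈ I(x) such that p = Σ_{i∈I(x)} λ_i ξ_i. -/
open Filter Topology RealInnerProductSpace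

open Metric

section Superdifferential

variable {E : Type*} [NormedAddCommGroup E] [InnerProductSpace ℝ E]

theorem mem_frechetSuperdiff_iff {u : E → ℝ} {x p : E} :
    p ∈ frechetSuperdiff u x ↔
      ∀ ε > 0, ∀ᶠ y in 𝓝 x, u y - u x - ⟪p, y - x⟫ ≤ ε * ‖y - x‖ := by
  refine forall₂_congr fun ε _ => ?_
  rw [eventually_nhdsWithin_iff]
  refine eventually_congr (Eventually.of_forall fun y => ?_)
  by_cases hy : y = x
  · simp [hy]
  · have : 0 < ‖y - x‖ := norm_pos_iff.2 (sub_ne_zero.2 hy)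
    simp [hy, div_le_iff₀ this]

/-- A gradient of a function touching `u` from above is a Fréchet supergradient of `u`. -/
theorem mem_frechetSuperdiff_of_eventually_le_s5 [CompleteSpace E] {u G : E → ℝ} {x q : E}
    (hG : HasGradientAt G q x) (hle : ∀ᶠ y in 𝓝 x, u y ≤ G y) (hx : u x = G x) :
    q ∈ frechetSuperdiff u x := by
  rw [mem_frechetSuperdiff_iff]
  intro ε hε
  have h := (hasGradientAt_iff_isLittleO.1 hG).def hε
  filter_upwards [h, hle] with y hy hy'
  have := (le_abs_self _).trans hy
  linarith

/-- Fréchet supergradients of a function are bounded by its local Lipschitz constant. -/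
theorem norm_le_of_mem_frechetSuperdiff {u : E → ℝ} {x p : E} {L : NNReal} {s : Set E}
    (hs : s ∈ 𝓝 x) (hL : LipschitzOnWith L u s) (hp : p ∈ frechetSuperdiff u x) :
    ‖p‖ ≤ L := by
  refine le_of_forall_pos_le_add fun ε hε => ?_
  rcases eq_or_ne p 0 with rfl | hp0
  · simp only [norm_zero]; positivity
  have hpn : 0 < ‖p‖ := norm_pos_iff.2 hp0
  have hev := (mem_frechetSuperdiff_iff.1 hp ε hε).and hs
  have hlim : Tendsto (fun t : ℝ => x - t • p) (𝓝[>] 0) (𝓝 x) := by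
    have : Tendsto (fun t : ℝ => x - t • p) (𝓝 0) (𝓝 (x - (0 : ℝ) • p)) :=
      Continuous.tendsto (by fun_prop) _
    rw [zero_smul, sub_zero] at this
    exact this.mono_left nhdsWithin_le_nhds
  obtain ⟨t, ⟨ht1, ht2⟩, ht⟩ := ((hlim.eventually hev).and self_mem_nhdsWithin).exists
  have ht : 0 < t := ht
  have hd := hL.dist_le_mul _ ht2 _ (mem_of_mem_nhds hs)
  rw [dist_eq_norm, Real.norm_eq_abs, dist_eq_norm] at hd
  have hsub : x - t • p - x = -(t • p) := by abel
  rw [hsub, norm_neg, norm_smul, Real.norm_of_nonneg ht.le] at hd ht1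
  rw [inner_neg_right, real_inner_smul_right, real_inner_self_eq_norm_sq] at ht1
  have h1 := neg_le_of_abs_le hd
  have h2 : (t * ‖p‖) * ‖p‖ ≤ (t * ‖p‖) * (L + ε) := by nlinarith
  exact le_of_mul_le_mul_left h2 (by positivity)

theorem hasGradientAt_const_mul_norm_sub_sq [CompleteSpace E] (c : ℝ) (a y : E) :
    HasGradientAt (fun w => c * ‖w - a‖ ^ 2) ((2 * c) • (y - a)) y := by
  rw [hasGradientAt_iff_hasFDerivAt]
  have h := (((hasFDerivAt_id y).sub_const a).norm_sq).const_mul c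
  refine h.congr_fderiv ?_
  ext v
  simp
  ring

end Superdifferential

section SoftMin

variable {ι : Type*} [Fintype ι]

/-- The smooth approximation `-(1/k) log ∑ exp (-k tᵢ)` of `min tᵢ`. -/
noncomputable def softMin (k : ℝ) (t : ι → ℝ) : ℝ :=
  -(1 / k) * Real.log (∑ i, Real.exp (-k * t i))

theorem sum_exp_pos [Nonempty ι] (k : ℝ) (t : ι → ℝ) : 0 < ∑ i, Real.exp (-k * t i) :=
  Finset.sum_pos (fun _ _ => Real.exp_pos _) Finset.univ_nonempty

theorem exp_neg_mul_softMin [Nonempty ι] {k : ℝ} (hk : 0 < k) (t : ι → ℝ) :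
    Real.exp (-k * softMin k t) = ∑ i, Real.exp (-k * t i) := by
  rw [softMin, show -k * (-(1 / k) * Real.log (∑ i, Real.exp (-k * t i))) =
    Real.log (∑ i, Real.exp (-k * t i)) by field_simp, Real.exp_log (sum_exp_pos k t)]

theorem softMin_le [Nonempty ι] {k : ℝ} (hk : 0 < k) (t : ι → ℝ) (i : ι) :
    softMin k t ≤ t i := by
  have h : Real.exp (-k * t i) ≤ Real.exp (-k * softMin k t) := by
    rw [exp_neg_mul_softMin hk]
    exact Finset.single_le_sum (f := fun i => Real.exp (-k * t i))
      (fun _ _ => (Real.exp_pos _).le) (Finset.mem_univ i)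
  rw [Real.exp_le_exp] at h
  nlinarith

theorem le_softMin [Nonempty ι] {k a : ℝ} (hk : 0 < k) (t : ι → ℝ) (ha : ∀ i, a ≤ t i) :
    a - Real.log (Fintype.card ι) / k ≤ softMin k t := by
  have hc : (0 : ℝ) < Fintype.card ι := by exact_mod_cast Fintype.card_pos
  have h : Real.exp (-k * softMin k t) ≤ Real.exp (Real.log (Fintype.card ι) + -k * a) := by
    rw [exp_neg_mul_softMin hk, Real.exp_add, Real.exp_log hc, ← nsmul_eq_mul]
    refine Finset.sum_le_card_nsmul _ _ _ fun i _ => Real.exp_le_exp.2 ?_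
    nlinarith [ha i]
  rw [Real.exp_le_exp] at h
  rw [sub_le_iff_le_add, ← sub_le_iff_le_add', le_div_iff₀ hk]
  linarith

theorem continuous_softMin [Nonempty ι] (k : ℝ) : Continuous (softMin k : (ι → ℝ) → ℝ) := by
  unfold softMin
  exact continuous_const.mul
    (Continuous.log (by fun_prop) fun t => (sum_exp_pos k t).ne')

/-- If the soft minimum of `f i (y i)` is, as a function of `y i`, bounded above by a smooth
function with gradient `a` touching it at `y i`, then `a` divided by the `i`-th softmin weight is a
Fréchet supergradient of `f i`. -/
theorem smul_mem_frechetSuperdiff_of_softMin_le {E : Type*} [NormedAddCommGroup E]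
    [InnerProductSpace ℝ E] [CompleteSpace E] [DecidableEq ι] [Nonempty ι] {k : ℝ} (hk : 0 < k)
    {f : ι → E → ℝ} {y : ι → E} {i : ι} {φ : E → ℝ} {a : E} (hφ : HasGradientAt φ a (y i))
    (h : ∀ᶠ w in 𝓝 (y i), softMin k (fun j => f j (Function.update y i w j)) - φ w ≤
      softMin k (fun j => f j (y j)) - φ (y i)) :
    ((∑ j, Real.exp (-k * f j (y j))) / Real.exp (-k * f i (y i))) • a ∈
      frechetSuperdiff (f i) (y i) := by
  set C := ∑ j, Real.exp (-k * f j (y j)) with hC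
  set R := ∑ j ∈ Finset.univ.erase i, Real.exp (-k * f j (y j)) with hR
  have hCR : Real.exp (-k * f i (y i)) + R = C :=
    Finset.add_sum_erase Finset.univ (fun j => Real.exp (-k * f j (y j))) (Finset.mem_univ i)
  have hupd : ∀ w, ∑ j, Real.exp (-k * f j (Function.update y i w j)) =
      Real.exp (-k * f i w) + R := by
    intro w
    rw [← Finset.add_sum_erase _ _ (Finset.mem_univ i), Function.update_self]
    congr 1
    refine Finset.sum_congr rfl fun j hj => ?_
    rw [Function.update_of_ne (Finset.ne_of_mem_erase hj)]
  set B : E → ℝ := fun w => C * Real.exp (-k * (φ w - φ (y i))) - R with hB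
  have hBy : B (y i) = Real.exp (-k * f i (y i)) := by simp [hB, ← hCR]
  have hgrad : HasGradientAt (fun w => -(1 / k) * Real.log (B w))
      ((C / Real.exp (-k * f i (y i))) • a) (y i) := by
    rw [hasGradientAt_iff_hasFDerivAt] at hφ ⊢
    have h1 : HasFDerivAt B _ (y i) :=
      ((((hφ.sub_const (φ (y i))).const_mul (-k)).exp).const_mul C).sub_const R
    have h2 := (h1.log (by rw [hBy]; exact (Real.exp_pos _).ne')).const_mul (-(1 / k))
    refine h2.congr_fderiv ?_
    ext v
    simp [hBy]
    field_simp
  have hcont : ∀ᶠ w in 𝓝 (y i), 0 < B w := by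
    have h1 : ContinuousAt B (y i) := by
      have := hφ.differentiableAt.continuousAt
      fun_prop
    exact h1.eventually (lt_mem_nhds (by rw [hBy]; exact Real.exp_pos _))
  refine mem_frechetSuperdiff_of_eventually_le_s5 hgrad ?_ ?_
  · filter_upwards [h, hcont] with w hw hBw
    have h1 : Real.exp (-k * (softMin k (fun j => f j (y j)) + (φ w - φ (y i)))) ≤
        Real.exp (-k * softMin k (fun j => f j (Function.update y i w j))) :=
      Real.exp_le_exp.2 (by nlinarith)
    rw [mul_add, Real.exp_add, exp_neg_mul_softMin hk, exp_neg_mul_softMin hk, hupd] at h1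
    have h2 : B w ≤ Real.exp (-k * f i w) := by simp only [hB]; linarith
    have h3 := (Real.log_le_iff_le_exp hBw).2 h2
    rw [neg_mul, one_div, ← neg_le_neg_iff, neg_neg, inv_mul_le_iff₀ hk]
    linarith
  · rw [hBy, Real.log_exp]
    field_simp

end SoftMin

/-- Fuzzy max rule: a Fréchet supergradient of a lower envelope is approximated by convex
combinations of Fréchet supergradients at nearby points, with softmin weights. -/
theorem exists_approx_convexCombination_frechetSuperdiff {E ι : Type*} [NormedAddCommGroup E]
    [InnerProductSpace ℝ E] [FiniteDimensional ℝ E] [Fintype ι] [Nonempty ι]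
    {f : ι → E → ℝ} {x p : E} {L : NNReal} {δ : ℝ} (hcont : ∀ i, Continuous (f i))
    (hδ : 0 < δ) (hL : ∀ i, LipschitzOnWith L (f i) (closedBall x δ))
    (hp : p ∈ frechetSuperdiff (fun y => ⨅ i, f i y) x) :
    ∃ (y : ι → E) (lam : ι → ℝ) (ξ : ι → E), (∀ i, y i ∈ ball x δ) ∧ (∀ i, 0 ≤ lam i) ∧
      ∑ i, lam i = 1 ∧ (∀ i, ξ i ∈ frechetSuperdiff (f i) (y i)) ∧
      ‖∑ i, lam i • ξ i - p‖ ≤ δ ∧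
      ∃ k ≥ 1 / δ, ∀ i j, lam i ≤ Real.exp (-k * (f i (y i) - f j (y j))) := by
  classical
  have := FiniteDimensional.proper_real E
  have := FiniteDimensional.complete ℝ E
  set ε : ℝ := δ / 4 with hεdef
  have hε : 0 < ε := by positivity
  obtain ⟨r₀, hr₀, hball⟩ := Metric.eventually_nhds_iff_ball.1 (mem_frechetSuperdiff_iff.1 hp ε hε)
  obtain ⟨r, hr, hrδ, hrr₀⟩ : ∃ r > 0, 2 * r ≤ δ ∧ r < r₀ :=
    ⟨min (δ / 2) (r₀ / 2), by positivity, by linarith [min_le_left (δ / 2) (r₀ / 2)],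
      by linarith [min_le_right (δ / 2) (r₀ / 2)]⟩
  set c : ℝ := (Fintype.card ι : ℝ) with hcdef
  have hc : 1 ≤ c := by rw [hcdef]; exact_mod_cast Fintype.card_pos (α := ι)
  have hlogc : 0 ≤ Real.log c := Real.log_nonneg hc
  have hL0 : (0 : ℝ) ≤ L := L.2
  obtain ⟨k, hk, hkδ, hkc⟩ : ∃ k > 0, 1 / δ ≤ k ∧ Real.log c / k ≤ ε * r / 4 := by
    have : 0 ≤ Real.log c * 4 / (ε * r) := by positivity
    have h' : 0 < 1 / δ := by positivity
    refine ⟨Real.log c * 4 / (ε * r) + 1 / δ, by positivity, by linarith, ?_⟩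
    rw [div_le_iff₀ (by positivity)]
    calc Real.log c = ε * r / 4 * (Real.log c * 4 / (ε * r)) := by field_simp
      _ ≤ _ := by gcongr; linarith
  obtain ⟨K, hK, hKr, hKc⟩ : ∃ K > 0, L + ε + 1 ≤ K * r ∧ c * (L ^ 2 / (4 * K)) ≤ ε * r / 4 := by
    have h1 : 0 ≤ c * L ^ 2 / (ε * r) := by positivity
    have h2 : 0 < (L + ε + 1) / r := by positivity
    refine ⟨(L + ε + 1) / r + c * L ^ 2 / (ε * r), by positivity, ?_, ?_⟩
    · rw [add_mul, div_mul_cancel₀ _ hr.ne']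
      linarith [mul_nonneg h1 hr.le]
    · rw [← mul_div_assoc, div_le_iff₀ (by positivity)]
      calc c * (L : ℝ) ^ 2 = ε * r / 4 * (4 * (c * L ^ 2 / (ε * r))) := by field_simp
        _ ≤ _ := by gcongr; linarith
  set Ψ : (ι → E) × E → ℝ := fun q =>
    softMin k (fun i => f i (q.1 i)) - ⟪p, q.2 - x⟫ - 2 * ε / r * ‖q.2 - x‖ ^ 2
      - ∑ i, K * ‖q.1 i - q.2‖ ^ 2 with hΨ
  have hΨc : Continuous Ψ := by
    have h1 : Continuous fun q : (ι → E) × E => softMin k (fun i => f i (q.1 i)) :=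
      (continuous_softMin k).comp (by fun_prop)
    fun_prop
  obtain ⟨⟨y, z⟩, hmem, hmax⟩ := ((isCompact_univ_pi fun _ : ι =>
    isCompact_closedBall x (2 * r)).prod (isCompact_closedBall x r)).exists_isMaxOn
    ⟨(fun _ => x, x), by simp [hr.le]⟩ hΨc.continuousOn
  simp only [Set.mem_prod, Set.mem_pi, Set.mem_univ, true_implies] at hmem
  obtain ⟨hy, hz⟩ := hmem
  have hmax' : ∀ (y' : ι → E) (z' : E), (∀ i, y' i ∈ closedBall x (2 * r)) →
      z' ∈ closedBall x r → Ψ (y', z') ≤ Ψ (y, z) := fun y' z' h1 h2 =>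
    hmax (Set.mk_mem_prod (fun i _ => h1 i) h2)
  have hzr : ‖z - x‖ ≤ r := by simpa [dist_eq_norm] using hz
  have hlow : (⨅ i, f i x) - Real.log c / k ≤ Ψ (y, z) := by
    refine le_trans ?_ (hmax' (fun _ => x) x (by simp [hr.le]) (by simp [hr.le]))
    simpa [hΨ] using le_softMin hk (fun i => f i x)
      fun i => ciInf_le (Set.finite_range fun i => f i x).bddBelow i
  have hquad : ∀ i, L * ‖y i - z‖ - K * ‖y i - z‖ ^ 2 ≤ L ^ 2 / (4 * K) := by
    intro i
    rw [le_div_iff₀ (by positivity)]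
    nlinarith [sq_nonneg (2 * K * ‖y i - z‖ - L)]
  have hsoft : softMin k (fun i => f i (y i)) ≤ (⨅ i, f i z) + ∑ i, L * ‖y i - z‖ := by
    obtain ⟨j, hj⟩ := exists_eq_ciInf_of_finite (f := fun i => f i z)
    have h1 := (hL j).dist_le_mul _ (closedBall_subset_closedBall hrδ (hy j)) _
      (closedBall_subset_closedBall (by linarith) hz)
    rw [dist_eq_norm, dist_eq_norm] at h1
    have h2 := (le_abs_self _).trans h1
    have h3 : L * ‖y j - z‖ ≤ ∑ i, L * ‖y i - z‖ :=
      Finset.single_le_sum (f := fun i => L * ‖y i - z‖) (fun _ _ => by positivity)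
        (Finset.mem_univ j)
    have h4 := softMin_le hk (fun i => f i (y i)) j
    rw [← hj]
    linarith
  have hup := hball z (closedBall_subset_ball hrr₀ hz)
  have hkey : 0 ≤ ε * r / 4 + ε * ‖z - x‖ - 2 * ε / r * ‖z - x‖ ^ 2
      + ∑ i, (L * ‖y i - z‖ - K * ‖y i - z‖ ^ 2) := by
    rw [Finset.sum_sub_distrib]
    simp only [hΨ] at hlow
    linarith
  have hzlt : z ∈ ball x r := by
    rw [mem_ball, dist_eq_norm]
    refine lt_of_le_of_ne hzr fun heq => ?_
    have h1 : ∑ i, (L * ‖y i - z‖ - K * ‖y i - z‖ ^ 2) ≤ c * (L ^ 2 / (4 * K)) := by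
      rw [hcdef, ← nsmul_eq_mul]
      exact Finset.sum_le_card_nsmul _ _ _ fun i _ => hquad i
    rw [heq, show 2 * ε / r * r ^ 2 = 2 * ε * r by field_simp] at hkey
    nlinarith [mul_pos hε hr]
  have hylt : ∀ i, y i ∈ ball x (2 * r) := by
    intro i
    have hd : ‖y i - z‖ < r := by
      by_contra! hd
      have h1 : ∑ j ∈ Finset.univ.erase i, (L * ‖y j - z‖ - K * ‖y j - z‖ ^ 2) ≤
          c * (L ^ 2 / (4 * K)) := by
        refine (Finset.sum_le_card_nsmul _ _ _ fun j _ => hquad j).trans ?_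
        rw [nsmul_eq_mul]
        gcongr
        rw [hcdef]
        exact_mod_cast Finset.card_le_univ _
      rw [← Finset.add_sum_erase _ _ (Finset.mem_univ i)] at hkey
      have h2 : ε * ‖z - x‖ - 2 * ε / r * ‖z - x‖ ^ 2 ≤ ε * r / 8 := by
        have : ε * r / 8 - (ε * ‖z - x‖ - 2 * ε / r * ‖z - x‖ ^ 2) =
            2 * ε / r * (‖z - x‖ - r / 4) ^ 2 := by field_simp; ring
        have : 0 ≤ 2 * ε / r * (‖z - x‖ - r / 4) ^ 2 := by positivity
        linarith
      have h3 : (L + ε + 1) * ‖y i - z‖ ≤ K * ‖y i - z‖ ^ 2 := by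
        calc (L + ε + 1) * ‖y i - z‖ ≤ (K * r) * ‖y i - z‖ := by gcongr
          _ ≤ (K * ‖y i - z‖) * ‖y i - z‖ := by gcongr
          _ = _ := by ring
      have h4 : ε * r ≤ ε * ‖y i - z‖ := by gcongr
      have h5 : 0 < ε * r := by positivity
      linarith
    rw [mem_ball, dist_eq_norm]
    calc ‖y i - x‖ ≤ ‖y i - z‖ + ‖z - x‖ := norm_sub_le_norm_sub_add_norm_sub _ _ _
      _ < 2 * r := by linarith
  set C := ∑ j, Real.exp (-k * f j (y j)) with hC
  have hCpos : 0 < C := sum_exp_pos k fun j => f j (y j)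
  have hstat : ∑ i, (2 * K) • (y i - z) = p + (4 * ε / r) • (z - x) := by
    have hgrad : HasFDerivAt (fun w => Ψ (y, w))
        (-innerSL ℝ p - innerSL ℝ ((2 * (2 * ε / r)) • (z - x))
          - ∑ i, innerSL ℝ ((2 * K) • (z - y i))) z := by
      have h1 : HasFDerivAt (fun w => ⟪p, w - x⟫) (innerSL ℝ p) z :=
        (innerSL ℝ p).hasFDerivAt.comp z ((hasFDerivAt_id z).sub_const x)
      have h2 := (hasGradientAt_const_mul_norm_sub_sq (2 * ε / r) x z).hasFDerivAt
      have h3 := HasFDerivAt.fun_sum (u := Finset.univ) fun i _ =>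
        (hasGradientAt_const_mul_norm_sub_sq K (y i) z).hasFDerivAt
      have h4 := ((h1.const_sub (softMin k fun i => f i (y i))).sub h2).sub h3
      simp only [hΨ, norm_sub_rev (y _)]
      exact h4
    have hloc : IsLocalMax (fun w => Ψ (y, w)) z := by
      filter_upwards [closedBall_mem_nhds_of_mem hzlt] with w hw
      exact hmax' y w hy hw
    have h0 := hloc.hasFDerivAt_eq_zero hgrad
    rw [← map_sum, ← map_neg, ← map_sub, ← map_sub, ← norm_eq_zero, innerSL_apply_norm,
      norm_eq_zero] at h0
    have h5 : ∑ i, (2 * K) • (y i - z) = -∑ i, (2 * K) • (z - y i) := by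
      rw [← Finset.sum_neg_distrib]
      exact Finset.sum_congr rfl fun i _ => by module
    rw [h5, show 4 * ε / r = 2 * (2 * ε / r) by ring]
    rw [← sub_eq_zero, ← h0]
    abel
  refine ⟨y, fun i => Real.exp (-k * f i (y i)) / C,
    fun i => (C / Real.exp (-k * f i (y i))) • (2 * K) • (y i - z),
    fun i => ball_subset_ball hrδ (hylt i), fun i => by positivity, ?_, fun i => ?_, ?_,
    k, hkδ, fun i j => ?_⟩
  · rw [← Finset.sum_div, div_self hCpos.ne']
  · refine smul_mem_frechetSuperdiff_of_softMin_le hk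
      (hasGradientAt_const_mul_norm_sub_sq K z (y i)) ?_
    filter_upwards [closedBall_mem_nhds_of_mem (hylt i)] with w hw
    have h1 := hmax' (Function.update y i w) z (fun j => by
      rcases eq_or_ne j i with rfl | hj
      · simpa using hw
      · rw [Function.update_of_ne hj]; exact hy j) hz
    simp only [hΨ] at h1
    rw [← Finset.add_sum_erase _ _ (Finset.mem_univ i),
      ← Finset.add_sum_erase _ (fun i => K * ‖y i - z‖ ^ 2) (Finset.mem_univ i),
      Function.update_self, Finset.sum_congr rfl fun j hj => by
        rw [Function.update_of_ne (Finset.ne_of_mem_erase hj)]] at h1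
    linarith
  · have h1 : ∀ i, (Real.exp (-k * f i (y i)) / C) • (C / Real.exp (-k * f i (y i))) •
        (2 * K) • (y i - z) = (2 * K) • (y i - z) := by
      intro i
      rw [smul_smul, div_mul_div_cancel₀ hCpos.ne', div_self (Real.exp_pos _).ne', one_smul]
    simp only [h1]
    rw [hstat, add_sub_cancel_left, norm_smul, Real.norm_of_nonneg (by positivity)]
    calc 4 * ε / r * ‖z - x‖ ≤ 4 * ε / r * r := by gcongr
      _ = δ := by rw [hεdef]; field_simp
  · rw [div_le_iff₀ hCpos]
    have h1 : Real.exp (-k * f j (y j)) ≤ C :=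
      Finset.single_le_sum (f := fun j => Real.exp (-k * f j (y j)))
        (fun _ _ => (Real.exp_pos _).le) (Finset.mem_univ j)
    calc Real.exp (-k * f i (y i)) =
        Real.exp (-k * (f i (y i) - f j (y j))) * Real.exp (-k * f j (y j)) := by
          rw [← Real.exp_add]; ring_nf
      _ ≤ _ := by gcongr

theorem exists_forall_lipschitzOnWith_closedBall {E ι : Type*} [PseudoMetricSpace E] [Finite ι]
    {f : ι → E → ℝ} (hf : ∀ i, LocallyLipschitz (f i)) (x : E) :
    ∃ (L : NNReal) (R : ℝ), 0 < R ∧ ∀ i, LipschitzOnWith L (f i) (closedBall x R) := by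
  cases nonempty_fintype ι
  choose K t ht hK using fun i => hf i x
  obtain ⟨R, hR, hsub⟩ := nhds_basis_closedBall.mem_iff.1 (iInter_mem.2 ht)
  refine ⟨∑ i, K i, R, hR, fun i => ((hK i).mono
    (hsub.trans (Set.iInter_subset _ i))).weaken ?_⟩
  exact Finset.single_le_sum (fun _ _ => zero_le) (Finset.mem_univ i)

/-- Max rule for lower envelopes of locally Lipschitz functions:
every Fréchet supergradient of the lower envelope `ū = min_i f_i` is a convex combination,
over the active index set `I(x) = {i : f_i(x) = ū(x)}`, of limiting supergradients of the
active functions. -/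
theorem stmt5 (N m : ℕ) (hN : 1 ≤ N) (hm : 1 ≤ m)
    (f : Fin m → EuclideanSpace ℝ (Fin N) → ℝ)
    (hLip : ∀ i, LocallyLipschitz (f i))
    (x : EuclideanSpace ℝ (Fin N)) (p : EuclideanSpace ℝ (Fin N))
    (hp : p ∈ frechetSuperdiff (fun y => ⨅ i, f i y) x) :
    ∃ lam : Fin m → ℝ, ∃ ξ : Fin m → EuclideanSpace ℝ (Fin N),
      (∀ i, 0 ≤ lam i) ∧
      (∀ i, f i x ≠ (⨅ k, f k x) → lam i = 0) ∧
      (∑ i, lam i) = 1 ∧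
      (∀ i, f i x = (⨅ k, f k x) → ξ i ∈ limitingSuperdiff (f i) x) ∧
      p = ∑ i, lam i • ξ i := by
  have : Nonempty (Fin m) := ⟨⟨0, hm⟩⟩
  have hcont := fun i => (hLip i).continuous
  obtain ⟨L, R, hR, hL⟩ := exists_forall_lipschitzOnWith_closedBall hLip x
  set δ : ℕ → ℝ := fun n => min R (1 / (n + 1)) with hδ
  have hδpos : ∀ n, 0 < δ n := fun n => lt_min hR (by positivity)
  have hδR : ∀ n, δ n ≤ R := fun n => min_le_left _ _
  have hδ0 : Tendsto δ atTop (𝓝 0) :=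
    squeeze_zero (fun n => (hδpos n).le) (fun n => min_le_right _ _)
      tendsto_one_div_add_atTop_nhds_zero_nat
  choose y lam ξ hy hlam hsum hξ happrox k hk hexp using fun n =>
    exists_approx_convexCombination_frechetSuperdiff hcont (hδpos n)
      (fun i => (hL i).mono (closedBall_subset_closedBall (hδR n))) hp
  have hlam1 : ∀ n i, lam n i ≤ 1 := fun n i => by
    rw [← hsum n]
    exact Finset.single_le_sum (fun j _ => hlam n j) (Finset.mem_univ i)
  have hξL : ∀ n i, ‖ξ n i‖ ≤ L := fun n i =>
    norm_le_of_mem_frechetSuperdiff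
      (closedBall_mem_nhds_of_mem (ball_subset_ball (hδR n) (hy n i))) (hL i) (hξ n i)
  obtain ⟨⟨l, η⟩, -, φ, hφ, hlim⟩ := ((isCompact_univ_pi fun _ : Fin m =>
    isCompact_Icc (a := (0 : ℝ)) (b := 1)).prod (isCompact_univ_pi fun _ : Fin m =>
    isCompact_closedBall (0 : EuclideanSpace ℝ (Fin N)) L)).tendsto_subseq
    (x := fun n => (lam n, ξ n)) fun n => Set.mk_mem_prod
      (fun i _ => ⟨hlam n i, hlam1 n i⟩) (fun i _ => by simpa using hξL n i)
  have hl : ∀ i, Tendsto (fun n => lam (φ n) i) atTop (𝓝 (l i)) :=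
    tendsto_pi_nhds.1 hlim.fst_nhds
  have hη : ∀ i, Tendsto (fun n => ξ (φ n) i) atTop (𝓝 (η i)) :=
    tendsto_pi_nhds.1 hlim.snd_nhds
  have hδφ := hδ0.comp hφ.tendsto_atTop
  have hyx : ∀ i, Tendsto (fun n => y (φ n) i) atTop (𝓝 x) := fun i =>
    tendsto_iff_dist_tendsto_zero.2
      (squeeze_zero (fun _ => dist_nonneg) (fun n => (hy (φ n) i).le) hδφ)
  have hktop : Tendsto (fun n => k (φ n)) atTop atTop := by
    refine tendsto_atTop_mono (fun n => hk (φ n)) ?_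
    simp only [one_div]
    exact (tendsto_nhdsWithin_iff.2
      ⟨hδφ, Eventually.of_forall fun n => hδpos (φ n)⟩).inv_tendsto_nhdsGT_zero
  refine ⟨l, η, fun i => ge_of_tendsto' (hl i) fun n => hlam _ i, fun i hi => ?_, ?_,
    fun i _ => ⟨fun n => y (φ n) i, fun n => ξ (φ n) i, hyx i, hη i, fun n => hξ _ i⟩, ?_⟩
  · obtain ⟨j, hj⟩ := exists_eq_ciInf_of_finite (f := fun i => f i x)
    have hgap : 0 < f i x - f j x :=
      sub_pos.2 (hj ▸ lt_of_le_of_ne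
        (ciInf_le (Set.finite_range fun i => f i x).bddBelow i) (Ne.symm hi))
    have hgaplim : Tendsto (fun n => f i (y (φ n) i) - f j (y (φ n) j)) atTop
        (𝓝 (f i x - f j x)) :=
      (((hcont i).tendsto x).comp (hyx i)).sub (((hcont j).tendsto x).comp (hyx j))
    have hzero : Tendsto (fun n => Real.exp (-k (φ n) * (f i (y (φ n) i) - f j (y (φ n) j))))
        atTop (𝓝 0) := by
      simp only [neg_mul]
      exact Real.tendsto_exp_neg_atTop_nhds_zero.comp (hktop.atTop_mul_pos hgap hgaplim)
    exact tendsto_nhds_unique (hl i)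
      (squeeze_zero (fun n => hlam _ i) (fun n => hexp _ i j) hzero)
  · refine tendsto_nhds_unique (tendsto_finsetSum Finset.univ fun i _ => hl i) ?_
    simp [hsum]
  · refine tendsto_nhds_unique (tendsto_iff_norm_sub_tendsto_zero.2
      (squeeze_zero (fun _ => norm_nonneg _) (fun n => happrox (φ n)) hδφ)) ?_
    exact tendsto_finsetSum Finset.univ fun i _ => (hl i).smul (hη i)
end

section
/- (Key step of Theorem 3.2: coordinate extension of a one-dimensional viscosity solution) Let m ≥ 1, r ≥ 0, ρ_a, ρ_b ≥ 0, and for each j = 1, …, m let g_j, h_j, l_j : ℝ → ℝ with g_j ≥ 0 and h_j ≥ 0. Define the one-dimensional Hamiltonian H_i(s, k) = ρ_a g_i(s)|k| − ρ_b h_i(s)|k| − l_i(s) k − 1 for s, k ∈ ℝ, and the full Hamiltonian H(x, p) = ρ_a Σ_{j=1}^m g_j(x_j)|p_j| − ρ_b |Σ_{j=1}^m h_j(x_j) p_j| − Σ_{j=1}^m l_j(x_j) p_j − 1 for x, p ∈ ℝ^m. Fix i and suppose v : ℝ → ℝ is both a viscosity subsolution and a viscosity supersolution of v + H_i(s, v')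 = 0 on (r, ∞). Then u(x) = v(x_i) is both a viscosity subsolution and a viscosity supersolution of u + H(x, Du) = 0 on the open set {x ∈ ℝ^m : x_i > r}. -/
open Filter Topology RealInnerProductSpace

section FrechetDifferentials

variable {E : Type*} [NormedAddCommGroup E] [InnerProductSpace ℝ E]

theorem mem_frechetSubdiff_iff_neg {u : E → ℝ} {x p : E} :
    p ∈ frechetSubdiff u x ↔ -p ∈ frechetSuperdiff (fun y => -u y) x := by
  refine forall₂_congr fun ε _ => eventually_congr (Eventually.of_forall fun y => ?_)
  have : (-u y - -u x - ⟪-p, y - x⟫) / ‖y - x‖ = -((u y - u x - ⟪p, y - x⟫) / ‖y - x‖) := by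
    rw [inner_neg_left]; ring
  rw [this, neg_le]

/-- Superdifferentials restrict to lines with a unit direction. -/
theorem inner_mem_frechetSuperdiff_line {u : E → ℝ} {x p e : E}
    (hp : p ∈ frechetSuperdiff u x) (he : ‖e‖ = 1) (s₀ : ℝ) :
    ⟪p, e⟫ ∈ frechetSuperdiff (fun s : ℝ => u (x + (s - s₀) • e)) s₀ := by
  intro ε hε
  have hne : e ≠ 0 := by rintro rfl; simp at he
  have hlim : Tendsto (fun s : ℝ => x + (s - s₀) • e) (𝓝[≠] s₀) (𝓝[≠] x) := by
    refine tendsto_nhdsWithin_iff.2 ⟨?_, ?_⟩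
    · have hc : Continuous fun s : ℝ => x + (s - s₀) • e := by fun_prop
      simpa using (hc.tendsto s₀).mono_left nhdsWithin_le_nhds
    · filter_upwards [self_mem_nhdsWithin] with s hs
      simpa [hne, sub_eq_zero] using hs
  filter_upwards [hlim.eventually (hp ε hε)] with s hs
  simpa [norm_smul, he, inner_smul_right] using hs

theorem eq_zero_of_mem_frechetSuperdiff_const {c s₀ q : ℝ}
    (hq : q ∈ frechetSuperdiff (fun _ : ℝ => c) s₀) : q = 0 := by
  have key : ∀ ε > 0, |q| ≤ ε := by
    intro ε hε
    have h := hq ε hε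
    obtain ⟨a, ha', ha⟩ := ((h.filter_mono (nhdsGT_le_nhdsNE s₀)).and
      (self_mem_nhdsWithin : Set.Ioi s₀ ∈ 𝓝[>] s₀)).exists
    obtain ⟨b, hb', hb⟩ := ((h.filter_mono (nhdsLT_le_nhdsNE s₀)).and
      (self_mem_nhdsWithin : Set.Iio s₀ ∈ 𝓝[<] s₀)).exists
    have ha0 : 0 < a - s₀ := sub_pos.2 ha
    have hb0 : 0 < s₀ - b := sub_pos.2 hb
    rw [Real.norm_eq_abs, abs_of_pos ha0, div_le_iff₀ ha0] at ha'
    rw [Real.norm_eq_abs, abs_sub_comm, abs_of_pos hb0, div_le_iff₀ hb0] at hb'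
    simp only [sub_self, zero_sub, RCLike.inner_apply, conj_trivial] at ha' hb'
    rw [abs_le]
    constructor <;> nlinarith
  exact abs_nonpos_iff.1 (le_of_forall_pos_le_add fun ε hε => by simpa using key ε hε)

end FrechetDifferentials

theorem frechetSuperdiff_comp_coord {ι : Type*} [Fintype ι] {v : ℝ → ℝ} {i : ι}
    {x p : EuclideanSpace ℝ ι} (hp : p ∈ frechetSuperdiff (fun y => v (y i)) x) :
    p i ∈ frechetSuperdiff v (x i) ∧ ∀ j, j ≠ i → p j = 0 := by
  classical
  have key (j : ι) := inner_mem_frechetSuperdiff_line hp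
    (e := EuclideanSpace.single j (1 : ℝ)) (by simp) (x j)
  refine ⟨by simpa [EuclideanSpace.inner_single_right] using key i, fun j hj => ?_⟩
  refine eq_zero_of_mem_frechetSuperdiff_const (c := v (x i)) (s₀ := x j) ?_
  simpa [EuclideanSpace.inner_single_right, hj.symm] using key j

theorem frechetSubdiff_comp_coord {ι : Type*} [Fintype ι] {v : ℝ → ℝ} {i : ι}
    {x p : EuclideanSpace ℝ ι} (hp : p ∈ frechetSubdiff (fun y => v (y i)) x) :
    p i ∈ frechetSubdiff v (x i) ∧ ∀ j, j ≠ i → p j = 0 := by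
  rw [mem_frechetSubdiff_iff_neg] at hp ⊢
  simpa using frechetSuperdiff_comp_coord (v := fun s => -v s) hp

/-- Key step of Theorem 3.2: the extension `u(x) = v(x_i)` of a one-dimensional
viscosity solution is a viscosity solution of the full `m`-dimensional equation. -/
theorem stmt8 (m : ℕ) (hm : 1 ≤ m) (r ρa ρb : ℝ)
    (hr : 0 ≤ r) (hρa : 0 ≤ ρa) (hρb : 0 ≤ ρb)
    (g h l : Fin m → ℝ → ℝ) (hg : ∀ j s, 0 ≤ g j s) (hh : ∀ j s, 0 ≤ h j s)
    (i : Fin m)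
    (Hi : ℝ → ℝ → ℝ)
    (hHi : ∀ s k, Hi s k = ρa * g i s * |k| - ρb * h i s * |k| - l i s * k - 1)
    (H : EuclideanSpace ℝ (Fin m) → EuclideanSpace ℝ (Fin m) → ℝ)
    (hHdef : ∀ x p, H x p =
      ρa * ∑ j, g j (x j) * |p j| - ρb * |∑ j, h j (x j) * p j|
        - (∑ j, l j (x j) * p j) - 1)
    (v : ℝ → ℝ)
    (hvsub : IsSubsolution Hi v (Set.Ioi r))
    (hvsup : IsSupersolution Hi v (Set.Ioi r)) :
    IsSubsolution H (fun x => v (x i)) {x | r < x i} ∧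
    IsSupersolution H (fun x => v (x i)) {x | r < x i} := by
  have hH (x p : EuclideanSpace ℝ (Fin m)) (hp : ∀ j, j ≠ i → p j = 0) :
      H x p = Hi (x i) (p i) := by
    rw [hHdef, hHi, Finset.sum_eq_single i (fun j _ hj => by simp [hp j hj]) (by simp),
      Finset.sum_eq_single i (fun j _ hj => by simp [hp j hj]) (by simp),
      Finset.sum_eq_single i (fun j _ hj => by simp [hp j hj]) (by simp),
      abs_mul, abs_of_nonneg (hh i (x i))]
    ring
  constructor
  · intro x hx p hp
    obtain ⟨hpi, hp0⟩ := frechetSuperdiff_comp_coord hp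
    rw [hH x p hp0]
    exact hvsub (x i) hx (p i) hpi
  · intro x hx p hp
    obtain ⟨hpi, hp0⟩ := frechetSubdiff_comp_coord hp
    rw [hH x p hp0]
    exact hvsup (x i) hx (p i) hpi
end
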